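/- Let N ≥ 2 and let E_0, E_1, …, E_m be Lebesgue measurable, essentially pairwise disjoint subsets of ℝ^N whose union is ℝ^N up to a Lebesgue-null set, each with positive Lebesgue measure and with H^{N−1}(∂^e E_i) < ∞ for every i. For i ≠ j in {0, 1, …, m} declare i ~ j if H^{N−1}(∂^e E_i ∩ ∂^e E_j) > 0 and, in addition, either i = 0, or j = 0, or H^{N−1}(∂^e E_i ∩ ∂^e E_0) = 0, or H^{N−1}(∂^e E_j ∩ ∂^e E_0) = 0. Then the equivalence relation generated by ~ on {0, 1, …, m} has a single equivalence class, i.e. every two indices are related by a finite chain of ~-related indices. -/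

import Mathlib

open MeasureTheory Metric Set Filter

noncomputable section

abbrev Pt (N : ℕ) := EuclideanSpace ℝ (Fin N)

variable {N : ℕ}

/-- The density ratio of `E` at `x` tends to `l` as the radius tends to `0⁺`. -/
def densTendsto (E : Set (Pt N)) (x : Pt N) (l : ENNReal) : Prop :=
  Tendsto (fun r : ℝ => volume (E ∩ ball x r) / volume (ball x r))
    (nhdsWithin 0 (Ioi 0)) (nhds l)

/-- The essential boundary of a set. -/
def essBdry (E : Set (Pt N)) : Set (Pt N) :=
  {x | ¬ densTendsto E x 0 ∧ ¬ densTendsto E x 1}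

/-- Weighted volume (as an extended nonnegative real). -/
def wVolE (f : Pt N → ℝ) (E : Set (Pt N)) : ENNReal :=
  ∫⁻ x in E, ENNReal.ofReal (f x) ∂(μH[(N : ℝ)])

/-- Weighted volume. -/
def wVol (f : Pt N → ℝ) (E : Set (Pt N)) : ℝ := (wVolE f E).toReal

/-- Weighted perimeter. -/
def wPer (g : Pt N → ℝ) (E : Set (Pt N)) : ℝ :=
  (∫⁻ x in essBdry E, ENNReal.ofReal (g x) ∂(μH[(N : ℝ) - 1])).toReal

/-- A density pair: lower semicontinuous, positive, locally bounded functions. -/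
def IsDensityPair (f g : Pt N → ℝ) : Prop :=
  LowerSemicontinuous f ∧ LowerSemicontinuous g ∧
  (∀ x, 0 < f x) ∧ (∀ x, 0 < g x) ∧
  ∀ K : Set (Pt N), IsCompact K → ∃ C : ℝ, ∀ x ∈ K, f x ≤ C ∧ g x ≤ C

/-- `g` is locally `α`-Hölder. -/
def LocallyHolder (α : ℝ) (g : Pt N → ℝ) : Prop :=
  ∀ K : Set (Pt N), IsCompact K → ∃ C : ℝ, ∀ y ∈ K, ∀ z ∈ K, |g y - g z| ≤ C * dist y z ^ α

/-- An `m`-cluster: measurable, essentially pairwise disjoint chambers. -/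
def IsCluster {m : ℕ} (E : Fin m → Set (Pt N)) : Prop :=
  (∀ i, MeasurableSet (E i)) ∧ ∀ i j, i ≠ j → volume (E i ∩ E j) = 0

/-- The chambers of a cluster including the exterior chamber `E₀`. -/
def chamber {m : ℕ} (E : Fin m → Set (Pt N)) (i : Fin (m + 1)) : Set (Pt N) :=
  if h : i = 0 then (⋃ j, E j)ᶜ else E (i.pred h)

/-- The weighted perimeter of a cluster. -/
def clPer (g : Pt N → ℝ) {m : ℕ} (E : Fin m → Set (Pt N)) : ℝ :=
  ((∑ i, wPer g (E i)) + wPer g (⋃ i, E i)) / 2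

/-- The cluster has finite perimeter. -/
def FinPerCluster {m : ℕ} (E : Fin m → Set (Pt N)) : Prop :=
  ∀ i, μH[(N : ℝ) - 1] (essBdry (E i)) < ⊤

/-- The cluster has finite weighted volume. -/
def FinVolCluster (f : Pt N → ℝ) {m : ℕ} (E : Fin m → Set (Pt N)) : Prop :=
  ∀ i, wVolE f (E i) < ⊤

/-- Nondegeneracy: all chambers including the exterior one have positive Lebesgue measure. -/
def Nondegenerate {m : ℕ} (E : Fin m → Set (Pt N)) : Prop :=
  0 < volume ((⋃ i, E i)ᶜ) ∧ ∀ i, 0 < volume (E i)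

/-- The `ε`–`ε^β` property for clusters with constants `(rbar, εbar, Cper)`. -/
def EpsEpsBeta (f g : Pt N → ℝ) {m : ℕ} (E : Fin m → Set (Pt N))
    (β rbar εbar Cper : ℝ) : Prop :=
  ∀ ε : EuclideanSpace ℝ (Fin m), ‖ε‖ < εbar → ∀ w : Pt N,
    ∃ F : Fin m → Set (Pt N), IsCluster F ∧
      (∃ (c : Fin (m * (m + 1) / 2 + 1) → Pt N) (ρ : Fin (m * (m + 1) / 2 + 1) → ℝ),
        (∀ k, ρ k ≤ rbar) ∧
        (∀ k, Disjoint (ball (c k) (ρ k)) (ball w rbar)) ∧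
        (⋃ i, symmDiff (E i) (F i)) ⊆ ⋃ k, ball (c k) (ρ k)) ∧
      (∀ i, wVol f (F i) = wVol f (E i) + ε i) ∧
      clPer g F ≤ clPer g E + Cper * ‖ε‖ ^ β

open scoped Topology

/-- The points `x` of the cylinder `ℝ × ℝⁿ` (with the sup distance) such that `E` occupies a small
proportion of every ball centred at `x` with radius less than `δ`. -/
def smallDensitySet {n : ℕ} (E : Set (ℝ × (Fin n → ℝ))) (δ : ℝ) : Set (ℝ × (Fin n → ℝ)) :=
  {x | ∀ r ∈ Ioo 0 δ, volume (E ∩ ball x r) ≤ ENNReal.ofReal ((1 / 3) ^ (n + 2) * r ^ (n + 1))}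

theorem volume_ball_prod_pi {n : ℕ} (x : ℝ × (Fin n → ℝ)) {r : ℝ} (hr : 0 < r) :
    volume (ball x r) = ENNReal.ofReal ((2 * r) ^ (n + 1)) := by
  obtain ⟨a, z⟩ := x
  rw [← ball_prod_same, Measure.volume_eq_prod, Measure.prod_prod, Real.volume_ball,
    Real.volume_pi_ball _ hr, ← ENNReal.ofReal_mul (by positivity), Fintype.card_fin, pow_succ']

theorem volume_closedBall_prod_pi {n : ℕ} (x : ℝ × (Fin n → ℝ)) {r : ℝ} (hr : 0 ≤ r) :
    volume (closedBall x r) = ENNReal.ofReal ((2 * r) ^ (n + 1)) := by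
  obtain ⟨a, z⟩ := x
  rw [← closedBall_prod_same, Measure.volume_eq_prod, Measure.prod_prod, Real.volume_closedBall,
    Real.volume_pi_closedBall _ hr, ← ENNReal.ofReal_mul (by positivity), Fintype.card_fin,
    pow_succ']

theorem smallDensitySet_anti {n : ℕ} (E : Set (ℝ × (Fin n → ℝ))) :
    Antitone (smallDensitySet E) :=
  fun _ _ h _ hx r hr ↦ hx r ⟨hr.1, hr.2.trans_le h⟩

theorem isOpen_setOf_lt_measure_inter_ball {X : Type*} [PseudoMetricSpace X] [MeasurableSpace X]
    (μ : Measure X) (E : Set X) (r : ℝ) (c : ENNReal) : IsOpen {x | c < μ (E ∩ ball x r)} := by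
  rw [Metric.isOpen_iff]
  intro x hx
  have hU : E ∩ ball x r = ⋃ m : ℕ, E ∩ ball x (r - 1 / ((m : ℝ) + 1)) := by
    rw [← inter_iUnion]
    congr 1
    ext y
    simp only [mem_ball, mem_iUnion]
    constructor
    · intro h
      obtain ⟨m, hm⟩ := exists_nat_one_div_lt (sub_pos.2 h)
      exact ⟨m, by linarith⟩
    · rintro ⟨m, hm⟩
      have : 0 < 1 / ((m : ℝ) + 1) := by positivity
      linarith
  have hmono : Monotone fun m : ℕ ↦ E ∩ ball x (r - 1 / ((m : ℝ) + 1)) := by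
    intro m m' h
    refine inter_subset_inter_right _ (ball_subset_ball ?_)
    have := one_div_le_one_div_of_le (by positivity : (0 : ℝ) < m + 1)
      (by exact_mod_cast Nat.succ_le_succ h : (m : ℝ) + 1 ≤ m' + 1)
    linarith
  rw [mem_ofPred_eq, hU, hmono.measure_iUnion, lt_iSup_iff] at hx
  obtain ⟨m, hm⟩ := hx
  refine ⟨1 / ((m : ℝ) + 1), by positivity, fun y hy ↦ hm.trans_le (measure_mono ?_)⟩
  refine inter_subset_inter_right _ (ball_subset_ball' ?_)
  rw [mem_ball'] at hy
  linarith

theorem isClosed_smallDensitySet {n : ℕ} (E : Set (ℝ × (Fin n → ℝ))) (δ : ℝ) :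
    IsClosed (smallDensitySet E δ) := by
  simp only [smallDensitySet, ofPred_forall]
  refine isClosed_biInter fun r _ ↦ ?_
  rw [← isOpen_compl_iff]
  simpa only [compl_ofPred, not_le] using isOpen_setOf_lt_measure_inter_ball volume E r _

theorem disjoint_smallDensitySet_compl {n : ℕ} (E : Set (ℝ × (Fin n → ℝ))) {δ δ' : ℝ}
    (hδ : 0 < δ) (hδ' : 0 < δ') : Disjoint (smallDensitySet E δ) (smallDensitySet Eᶜ δ') := by
  rw [Set.disjoint_left]
  intro x hx hx'
  have hr : 0 < min δ δ' / 2 := by positivity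
  set r := min δ δ' / 2
  have h1 := hx r ⟨hr, by have := min_le_left δ δ'; simp only [r]; linarith⟩
  have h2 := hx' r ⟨hr, by have := min_le_right δ δ'; simp only [r]; linarith⟩
  have h3 : volume (ball x r) ≤ volume (E ∩ ball x r) + volume (Eᶜ ∩ ball x r) := by
    refine (measure_mono ?_).trans (measure_union_le _ _)
    rw [← union_inter_distrib_right, union_compl_self, univ_inter]
  rw [volume_ball_prod_pi x hr] at h3
  have h4 := h3.trans (add_le_add h1 h2)
  rw [← ENNReal.ofReal_add (by positivity) (by positivity),
    ENNReal.ofReal_le_ofReal_iff (by positivity), mul_pow] at h4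
  have h5 : ((1 : ℝ) / 3) ^ (n + 2) ≤ 1 / 3 := by
    simpa using pow_le_pow_of_le_one (by norm_num) (by norm_num : (1 : ℝ) / 3 ≤ 1)
      (by omega : 1 ≤ n + 2)
  have h6 : (1 : ℝ) ≤ 2 ^ (n + 1) := one_le_pow₀ (by norm_num)
  have h7 : 0 < r ^ (n + 1) := by positivity
  nlinarith

theorem exists_mem_smallDensitySet {n : ℕ} {E : Set (ℝ × (Fin n → ℝ))} {x : ℝ × (Fin n → ℝ)}
    (h : ∀ᶠ r in 𝓝[>] (0 : ℝ),
      volume (E ∩ ball x r) ≤ ENNReal.ofReal ((1 / 3) ^ (n + 2) * r ^ (n + 1))) :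
    ∃ k : ℕ, x ∈ smallDensitySet E (1 / ((k : ℝ) + 1)) := by
  obtain ⟨ε, hε, hE⟩ := mem_nhdsGT_iff_exists_Ioo_subset.1 h
  obtain ⟨k, hk⟩ := exists_nat_one_div_lt (show (0 : ℝ) < ε from hε)
  exact ⟨k, fun r hr ↦ hE ⟨hr.1, hr.2.trans hk⟩⟩

theorem ae_exists_mem_smallDensitySet {n : ℕ} {E : Set (ℝ × (Fin n → ℝ))}
    (hE : MeasurableSet E) :
    ∀ᵐ x, x ∉ E → ∃ k : ℕ, x ∈ smallDensitySet E (1 / ((k : ℝ) + 1)) := by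
  filter_upwards [Besicovitch.ae_tendsto_measure_inter_div_of_measurableSet volume hE] with x hx hxE
  rw [indicator_of_notMem hxE] at hx
  apply exists_mem_smallDensitySet
  have hc : 0 < ENNReal.ofReal ((1 / 3) ^ (n + 2) / 2 ^ (n + 1)) := by
    rw [ENNReal.ofReal_pos]; positivity
  filter_upwards [hx.eventually_lt_const hc, self_mem_nhdsWithin] with r hr hr0
  have hr0 : 0 < r := hr0
  refine (measure_mono (inter_subset_inter_right E ball_subset_closedBall)).trans ?_
  have hv := volume_closedBall_prod_pi x hr0.le
  rw [ENNReal.div_lt_iff (Or.inl ?_) (Or.inl ?_), hv, ← ENNReal.ofReal_mul (by positivity)] at hr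
  · refine hr.le.trans_eq ?_
    congr 1
    rw [mul_pow]
    field_simp
  · rw [hv]
    exact (ENNReal.ofReal_pos.2 (by positivity)).ne'
  · rw [hv]
    exact ENNReal.ofReal_ne_top

theorem volume_image_snd_eq_zero_of_slab {n : ℕ} {E G : Set (ℝ × (Fin n → ℝ))}
    (hE : MeasurableSet E) {δ a : ℝ} (hδ : 0 < δ) (hG : G ⊆ smallDensitySet E δ)
    (hG' : ∀ x ∈ G, ∀ᵐ s, s ∈ Ioo x.1 (x.1 + δ) → (s, x.2) ∈ E)
    (ha : ∀ x ∈ G, x.1 ∈ Icc a (a + δ / 2)) :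
    volume (Prod.snd '' G) = 0 := by
  by_contra hA
  set A := Prod.snd '' G
  obtain ⟨z₀, hz₀⟩ : ∃ z₀, Tendsto (fun r ↦ volume (A ∩ closedBall z₀ r) / volume (closedBall z₀ r))
      (𝓝[>] 0) (𝓝 1) := by
    have : NeBot (ae (volume.restrict A)) := by
      rwa [ae_neBot, Ne, Measure.restrict_eq_zero]
    exact (Besicovitch.ae_tendsto_measure_inter_div volume A).exists
  obtain ⟨ρ, hρA, hρ0, hρδ⟩ : ∃ ρ : ℝ,
      2⁻¹ < volume (A ∩ closedBall z₀ ρ) / volume (closedBall z₀ ρ) ∧ 0 < ρ ∧ ρ < δ / 4 :=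
    ((hz₀.eventually_const_lt (by simp [ENNReal.inv_lt_one])).and
      (Ioo_mem_nhdsGT (by positivity : 0 < δ / 4))).exists
  have hvz : volume (closedBall z₀ ρ) = ENNReal.ofReal ((2 * ρ) ^ n) := by
    rw [Real.volume_pi_closedBall _ hρ0.le, Fintype.card_fin]
  have hvz0 : volume (closedBall z₀ ρ) ≠ 0 := by
    rw [hvz]; exact (ENNReal.ofReal_pos.2 (by positivity)).ne'
  rw [ENNReal.lt_div_iff_mul_lt (Or.inl hvz0) (Or.inl (by rw [hvz]; exact ENNReal.ofReal_ne_top)),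
    hvz] at hρA
  set S := Prod.fst '' (G ∩ Prod.snd ⁻¹' closedBall z₀ ρ)
  have hSne : S.Nonempty := by
    obtain ⟨_, ⟨x, hx, rfl⟩, hxz⟩ := nonempty_of_measure_ne_zero (ne_bot_of_gt hρA)
    exact ⟨x.1, x, ⟨hx, hxz⟩, rfl⟩
  have hSle : ∀ t ∈ S, t ≤ a + δ / 2 := by
    rintro _ ⟨x, hx, rfl⟩
    exact (ha x hx.1).2
  set M := sSup S
  have hMle : M ≤ a + δ / 2 := csSup_le hSne hSle
  have hleM : ∀ t ∈ S, t ≤ M := fun t ht ↦ le_csSup ⟨_, hSle⟩ ht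
  obtain ⟨_, ⟨x, ⟨hxG, hxz⟩, rfl⟩, hxM⟩ := exists_lt_of_lt_csSup hSne (sub_lt_self M hρ0)
  have hxM' := hleM _ ⟨x, ⟨hxG, hxz⟩, rfl⟩
  set K : Set (ℝ × (Fin n → ℝ)) := Ioo M (M + ρ) ×ˢ closedBall z₀ ρ
  have hKm : MeasurableSet (E ∩ K) :=
    hE.inter (measurableSet_Ioo.prod measurableSet_closedBall)
  have hK : K ⊆ ball x (3 * ρ) := by
    rintro ⟨s, z⟩ ⟨hs, hz⟩
    rw [mem_ball, Prod.dist_eq, max_lt_iff]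
    constructor
    · rw [Real.dist_eq, abs_lt]
      constructor <;> linarith [hs.1, hs.2]
    · have h1 : dist z z₀ ≤ ρ := hz
      have h2 : dist x.2 z₀ ≤ ρ := hxz
      have h3 := dist_triangle_right z x.2 z₀
      simp only
      linarith
  have hupper : volume (E ∩ K) ≤ ENNReal.ofReal ((1 / 3) ^ (n + 2) * (3 * ρ) ^ (n + 1)) :=
    (measure_mono (inter_subset_inter_right E hK)).trans
      (hG hxG (3 * ρ) ⟨by positivity, by linarith⟩)
  have hcol : ∀ z ∈ A ∩ closedBall z₀ ρ,
      ENNReal.ofReal ρ ≤ volume ((fun s : ℝ ↦ (s, z)) ⁻¹' (E ∩ K)) := by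
    rintro _ ⟨⟨y, hy, rfl⟩, hyz⟩
    have hyM := hleM _ ⟨y, ⟨hy, hyz⟩, rfl⟩
    have hv : volume (Ioo M (M + ρ)) = ENNReal.ofReal ρ := by simp
    rw [← hv]
    refine measure_mono_ae ?_
    filter_upwards [hG' y hy] with s hs hsM
    have hsM : s ∈ Ioo M (M + ρ) := hsM
    exact ⟨hs ⟨by linarith [hsM.1], by linarith [hsM.2, (ha y hy).1]⟩, hsM, hyz⟩
  have hlower : ENNReal.ofReal ρ * volume (A ∩ closedBall z₀ ρ) ≤ volume (E ∩ K) := by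
    rw [Measure.volume_eq_prod, Measure.prod_apply_symm hKm]
    refine le_trans ?_
      (mul_meas_ge_le_lintegral (measurable_measure_prodMk_right hKm) (ENNReal.ofReal ρ))
    gcongr
    exact hcol
  have h1 := ENNReal.mul_lt_mul_right (ENNReal.ofReal_pos.2 hρ0).ne' ENNReal.ofReal_ne_top hρA
  have h2 := (h1.trans_le hlower).trans_le hupper
  rw [show (2 : ENNReal)⁻¹ = ENNReal.ofReal 2⁻¹ by
      rw [ENNReal.ofReal_inv_of_pos two_pos, ENNReal.ofReal_ofNat],
    ← ENNReal.ofReal_mul (by positivity), ← ENNReal.ofReal_mul (by positivity),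
    ENNReal.ofReal_lt_ofReal_iff (by positivity)] at h2
  have h3 : ((1 : ℝ) / 3) ^ (n + 2) * (3 * ρ) ^ (n + 1) = 1 / 3 * (ρ * ρ ^ n) := by
    rw [mul_pow, pow_succ, one_div, inv_pow]
    field_simp
    ring
  have h4 : (1 : ℝ) ≤ 2 ^ n := one_le_pow₀ (by norm_num)
  have h5 : 0 < ρ * ρ ^ n := by positivity
  rw [h3, mul_pow] at h2
  nlinarith

/-- The points of `smallDensitySet E δ` above which the vertical segment of length `δ` lies almost
entirely in `E` project to a null set. -/
theorem volume_image_snd_eq_zero {n : ℕ} {E G : Set (ℝ × (Fin n → ℝ))} (hE : MeasurableSet E)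
    {δ : ℝ} (hδ : 0 < δ) (hG : G ⊆ smallDensitySet E δ)
    (hG' : ∀ x ∈ G, ∀ᵐ s, s ∈ Ioo x.1 (x.1 + δ) → (s, x.2) ∈ E) :
    volume (Prod.snd '' G) = 0 := by
  have hcov : Prod.snd '' G ⊆ ⋃ j : ℤ, Prod.snd ''
      (G ∩ Prod.fst ⁻¹' Icc (j * (δ / 2)) (j * (δ / 2) + δ / 2)) := by
    rintro _ ⟨x, hx, rfl⟩
    refine mem_iUnion.2 ⟨⌊x.1 / (δ / 2)⌋, x, ⟨hx, ?_, ?_⟩, rfl⟩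
    · rw [← le_div_iff₀ (by positivity)]
      exact Int.floor_le _
    · have := (div_le_iff₀ (by positivity : 0 < δ / 2)).1 (Int.lt_floor_add_one (x.1 / (δ / 2))).le
      linarith
  refine measure_mono_null hcov (measure_iUnion_null fun j ↦ ?_)
  exact volume_image_snd_eq_zero_of_slab hE hδ (inter_subset_left.trans hG)
    (fun x hx ↦ hG' x hx.1) fun x hx ↦ hx.2

/-- The points of `smallDensitySet E δ` below which the vertical segment of length `δ` lies almost
entirely in `E` project to a null set. -/
theorem volume_image_snd_eq_zero' {n : ℕ} {E G : Set (ℝ × (Fin n → ℝ))} (hE : MeasurableSet E)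
    {δ : ℝ} (hδ : 0 < δ) (hG : G ⊆ smallDensitySet E δ)
    (hG' : ∀ x ∈ G, ∀ᵐ s, s ∈ Ioo (x.1 - δ) x.1 → (s, x.2) ∈ E) :
    volume (Prod.snd '' G) = 0 := by
  set R : ℝ × (Fin n → ℝ) → ℝ × (Fin n → ℝ) := Prod.map Neg.neg id
  have hR : MeasurePreserving R volume volume :=
    (Measure.measurePreserving_neg volume).prod (MeasurePreserving.id volume)
  have hball : ∀ x r, R ⁻¹' ball (R x) r = ball x r := by
    intro x r
    ext y
    simp [R, Prod.dist_eq, dist_neg_neg]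
  have hRR : ∀ x, R (R x) = x := fun x ↦ Prod.ext (neg_neg x.1) rfl
  have himg : Prod.snd '' G = Prod.snd '' (R ⁻¹' G) := by
    ext z
    constructor
    · rintro ⟨x, hx, rfl⟩
      exact ⟨R x, by rwa [mem_preimage, hRR], rfl⟩
    · rintro ⟨x, hx, rfl⟩
      exact ⟨R x, hx, rfl⟩
  rw [himg]
  refine volume_image_snd_eq_zero (hR.measurable hE) hδ ?_ ?_
  · intro x hx r hr
    rw [← hball, ← preimage_inter, hR.measure_preimage (hE.inter measurableSet_ball).nullMeasurableSet]
    exact hG hx r hr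
  · intro x hx
    filter_upwards [(Measure.measurePreserving_neg (volume : Measure ℝ)).quasiMeasurePreserving.ae
      (hG' _ hx)] with s hs hsx
    exact hs ⟨by simp only [R, Prod.map]; linarith [hsx.2], by simp only [R, Prod.map]; linarith [hsx.1]⟩

theorem exists_Ioo_subset_compl_of_mem_frontier {S : Set ℝ} {A : ℕ → Set ℝ} (hmono : Monotone A)
    (hAS : ∀ k, A k ⊆ S) {p ε : ℝ} (hε : 0 < ε) (hp : p ∈ frontier S) {k : ℕ}
    (hk : ball p ε ∩ frontier S ⊆ A k) :
    ∃ j : ℕ, ∃ t ∈ A j, Ioo t (t + 1 / ((j : ℝ) + 1)) ⊆ Sᶜ ∨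
      Ioo (t - 1 / ((j : ℝ) + 1)) t ⊆ Sᶜ := by
  obtain ⟨q, hqS, hqp⟩ : ∃ q ∈ Sᶜ, dist p q < ε := by
    rw [← frontier_compl] at hp
    exact Metric.mem_closure_iff.1 (frontier_subset_closure hp) ε hε
  have hpq : p ≠ q := by
    rintro rfl
    exact hqS (hAS k (hk ⟨mem_ball_self hε, hp⟩))
  have hqF : q ∉ frontier S := fun h ↦ hqS (hAS k (hk ⟨by rwa [mem_ball'], h⟩))
  have hconn : ∀ T : Set ℝ, IsPreconnected T → q ∈ T → Disjoint T (frontier S) → T ⊆ Sᶜ := by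
    intro T hT hqT hd
    have h := hT.subset_or_subset isOpen_interior isOpen_interior
      (disjoint_compl_right.mono interior_subset interior_subset : Disjoint (interior S) (interior Sᶜ))
      (by
        intro x hx
        have := Set.disjoint_left.1 hd hx
        rw [interior_compl]
        by_contra hc
        rw [mem_union, not_or, mem_compl_iff, not_not] at hc
        exact this ⟨hc.2, hc.1⟩)
    rcases h with h | h
    · exact absurd (interior_subset (h hqT)) hqS
    · exact h.trans interior_subset
  rw [Real.dist_eq, abs_lt] at hqp
  rcases lt_or_gt_of_ne hpq with hlt | hlt
  · obtain ⟨t, ⟨htF, htI⟩, htmax⟩ := (isCompact_Icc.inter_left isClosed_frontier).exists_isGreatest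
      ⟨p, hp, left_mem_Icc.2 hlt.le⟩
    have htq : t < q := lt_of_le_of_ne htI.2 (by rintro rfl; exact hqF htF)
    obtain ⟨j, hj⟩ := exists_nat_one_div_lt (sub_pos.2 htq)
    refine ⟨max j k, t, hmono (le_max_right j k) (hk ⟨?_, htF⟩), Or.inl ?_⟩
    · rw [mem_ball, Real.dist_eq, abs_lt]
      constructor <;> linarith [htI.1]
    · refine Subset.trans ?_ (hconn (Ioc t q) isPreconnected_Ioc (right_mem_Ioc.2 htq) ?_)
      · have h1 : 1 / (((max j k : ℕ) : ℝ) + 1) ≤ 1 / ((j : ℝ) + 1) :=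
          Nat.one_div_le_one_div (le_max_left j k)
        exact fun s hs ↦ ⟨hs.1, by linarith [hs.2]⟩
      · rw [Set.disjoint_left]
        intro s hs hsF
        exact absurd (htmax ⟨hsF, htI.1.trans hs.1.le, hs.2⟩) (not_le.2 hs.1)
  · obtain ⟨t, ⟨htF, htI⟩, htmin⟩ := (isCompact_Icc.inter_left isClosed_frontier).exists_isLeast
      ⟨p, hp, right_mem_Icc.2 hlt.le⟩
    have htq : q < t := lt_of_le_of_ne htI.1 (by rintro rfl; exact hqF htF)
    obtain ⟨j, hj⟩ := exists_nat_one_div_lt (sub_pos.2 htq)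
    refine ⟨max j k, t, hmono (le_max_right j k) (hk ⟨?_, htF⟩), Or.inr ?_⟩
    · rw [mem_ball, Real.dist_eq, abs_lt]
      constructor <;> linarith [htI.2]
    · refine Subset.trans ?_ (hconn (Ico q t) isPreconnected_Ico (left_mem_Ico.2 htq) ?_)
      · have h1 : 1 / (((max j k : ℕ) : ℝ) + 1) ≤ 1 / ((j : ℝ) + 1) :=
          Nat.one_div_le_one_div (le_max_left j k)
        exact fun s hs ↦ ⟨by linarith [hs.1], hs.2⟩
      · rw [Set.disjoint_left]
        intro s hs hsF
        exact absurd (htmin ⟨hsF, hs.1, hs.2.le.trans htI.2⟩) (not_le.2 hs.2)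

/-- A Baire category argument: if the line is partitioned into two increasing unions of closed sets
which are both nonempty, then some point of one of the closed sets is the endpoint of an interval
of controlled length contained in the other union. -/
theorem exists_Ioo_subset_of_iUnion_union_iUnion {A B : ℕ → Set ℝ} (hA : ∀ k, IsClosed (A k))
    (hB : ∀ k, IsClosed (B k)) (hAm : Monotone A) (hBm : Monotone B)
    (hAB : (⋃ k, A k)ᶜ = ⋃ k, B k) (hAne : (⋃ k, A k).Nonempty) (hBne : (⋃ k, B k).Nonempty) :
    (∃ k : ℕ, ∃ t ∈ A k, Ioo t (t + 1 / ((k : ℝ) + 1)) ⊆ ⋃ k, B k ∨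
      Ioo (t - 1 / ((k : ℝ) + 1)) t ⊆ ⋃ k, B k) ∨
    (∃ k : ℕ, ∃ t ∈ B k, Ioo t (t + 1 / ((k : ℝ) + 1)) ⊆ ⋃ k, A k ∨
      Ioo (t - 1 / ((k : ℝ) + 1)) t ⊆ ⋃ k, A k) := by
  set S := ⋃ k, A k
  have hF : (frontier S).Nonempty :=
    nonempty_frontier_iff.2 ⟨hAne, fun h ↦ by rw [← hAB, h, compl_univ] at hBne; simp at hBne⟩
  have := hF.to_subtype
  have : CompleteSpace (frontier S) := isClosed_frontier.completeSpace_coe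
  obtain ⟨i, ⟨p, hp⟩, hpi⟩ := nonempty_interior_of_iUnion_of_closed
    (X := frontier S) (f := fun i : ℕ ⊕ ℕ ↦ Subtype.val ⁻¹' Sum.elim A B i)
    (by
      rintro (k | k)
      · exact (hA k).preimage continuous_subtype_val
      · exact (hB k).preimage continuous_subtype_val)
    (by
      rw [← preimage_iUnion, iUnion_sum]
      simp only [Sum.elim_inl, Sum.elim_inr]
      rw [← hAB, union_compl_self, preimage_univ])
  rw [mem_interior_iff_mem_nhds, Metric.mem_nhds_iff] at hpi
  obtain ⟨ε, hε, hpε⟩ := hpi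
  have hk : ball p ε ∩ frontier S ⊆ Sum.elim A B i := fun x hx ↦ @hpε ⟨x, hx.2⟩ hx.1
  rcases i with k | k
  · left
    rw [← hAB]
    exact exists_Ioo_subset_compl_of_mem_frontier hAm (fun j ↦ subset_iUnion A j) hε hp hk
  · right
    rw [← frontier_compl, hAB] at hp hk
    rw [← compl_compl S, hAB]
    exact exists_Ioo_subset_compl_of_mem_frontier hBm (fun j ↦ subset_iUnion B j) hε hp hk

/-- If almost every vertical line consists of points at which either `E` or its complement has
small density, then almost every vertical line is almost contained in `E` or in its complement. -/
theorem ae_vertical_line_trivial {n : ℕ} {E : Set (ℝ × (Fin n → ℝ))} (hE : MeasurableSet E)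
    (h : ∀ᵐ z : Fin n → ℝ, ∀ t : ℝ,
      (∃ k : ℕ, (t, z) ∈ smallDensitySet E (1 / ((k : ℝ) + 1))) ∨
      (∃ k : ℕ, (t, z) ∈ smallDensitySet Eᶜ (1 / ((k : ℝ) + 1)))) :
    ∀ᵐ z : Fin n → ℝ, (∀ᵐ t : ℝ, (t, z) ∉ E) ∨ (∀ᵐ t : ℝ, (t, z) ∈ E) := by
  have hslice : ∀ {p : ℝ × (Fin n → ℝ) → Prop}, (∀ᵐ x, p x) → ∀ᵐ z, ∀ᵐ t, p (t, z) := by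
    intro p hp
    exact Measure.ae_ae_of_ae_prod (Measure.measurePreserving_swap.quasiMeasurePreserving.ae hp)
  have hup : ∀ {F : Set (ℝ × (Fin n → ℝ))}, MeasurableSet F → ∀ᵐ z : Fin n → ℝ, ∀ k : ℕ, ∀ t : ℝ,
      (t, z) ∈ smallDensitySet F (1 / ((k : ℝ) + 1)) →
      (¬ ∀ᵐ s, s ∈ Ioo t (t + 1 / ((k : ℝ) + 1)) → (s, z) ∈ F) ∧
      (¬ ∀ᵐ s, s ∈ Ioo (t - 1 / ((k : ℝ) + 1)) t → (s, z) ∈ F) := by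
    intro F hF
    rw [ae_all_iff]
    intro k
    have hk : 0 < 1 / ((k : ℝ) + 1) := by positivity
    filter_upwards [measure_eq_zero_iff_ae_notMem.1 (volume_image_snd_eq_zero hF hk
        (G := {x ∈ smallDensitySet F (1 / ((k : ℝ) + 1)) |
          ∀ᵐ s, s ∈ Ioo x.1 (x.1 + 1 / ((k : ℝ) + 1)) → (s, x.2) ∈ F})
        (fun x hx ↦ hx.1) fun x hx ↦ hx.2),
      measure_eq_zero_iff_ae_notMem.1 (volume_image_snd_eq_zero' hF hk
        (G := {x ∈ smallDensitySet F (1 / ((k : ℝ) + 1)) |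
          ∀ᵐ s, s ∈ Ioo (x.1 - 1 / ((k : ℝ) + 1)) x.1 → (s, x.2) ∈ F})
        (fun x hx ↦ hx.1) fun x hx ↦ hx.2)] with z h1 h2 t ht
    exact ⟨fun h ↦ h1 ⟨(t, z), ⟨ht, h⟩, rfl⟩, fun h ↦ h2 ⟨(t, z), ⟨ht, h⟩, rfl⟩⟩
  filter_upwards [h, hslice (ae_exists_mem_smallDensitySet hE),
    hslice (ae_exists_mem_smallDensitySet hE.compl), hup hE, hup hE.compl]
    with z hz hzE hzE' hu hu'
  set A : ℕ → Set ℝ := fun k ↦ {t | (t, z) ∈ smallDensitySet E (1 / ((k : ℝ) + 1))}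
  set B : ℕ → Set ℝ := fun k ↦ {t | (t, z) ∈ smallDensitySet Eᶜ (1 / ((k : ℝ) + 1))}
  have hclosed : ∀ (F : Set (ℝ × (Fin n → ℝ))) (k : ℕ),
      IsClosed {t : ℝ | (t, z) ∈ smallDensitySet F (1 / ((k : ℝ) + 1))} := fun F k ↦
    (isClosed_smallDensitySet F _).preimage (by fun_prop : Continuous fun t : ℝ ↦ (t, z))
  have hmono : ∀ F : Set (ℝ × (Fin n → ℝ)),
      Monotone fun k : ℕ ↦ {t : ℝ | (t, z) ∈ smallDensitySet F (1 / ((k : ℝ) + 1))} :=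
    fun F k l hkl t ht ↦ smallDensitySet_anti F (Nat.one_div_le_one_div hkl) ht
  have hAB : (⋃ k, A k)ᶜ = ⋃ k, B k := by
    refine (compl_unique (disjoint_iff.1 ?_) ?_)
    · rw [Set.disjoint_left]
      intro t htA htB
      obtain ⟨k, ht⟩ := mem_iUnion.1 htA
      obtain ⟨l, ht'⟩ := mem_iUnion.1 htB
      exact Set.disjoint_left.1 (disjoint_smallDensitySet_compl E (by positivity) (by positivity))
        ht ht'
    · refine eq_univ_of_forall fun t ↦ ?_
      simpa [A, B] using hz t
  have hAE : ∀ᵐ t, t ∈ ⋃ k, A k → (t, z) ∉ E := by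
    filter_upwards [hzE'] with t ht htA htE
    rw [← compl_compl (⋃ k, A k), hAB] at htA
    exact htA (mem_iUnion.2 (ht (not_not.2 htE)))
  have hBE : ∀ᵐ t, t ∈ ⋃ k, B k → (t, z) ∈ E := by
    filter_upwards [hzE] with t ht htB
    by_contra htE
    rw [← hAB] at htB
    exact htB (mem_iUnion.2 (ht htE))
  by_contra hcon
  rw [not_or] at hcon
  have hBne : (⋃ k, B k).Nonempty := by
    by_contra hne
    rw [not_nonempty_iff_eq_empty] at hne
    refine hcon.1 (hAE.mono fun t ht ↦ ht ?_)
    rw [← compl_compl (⋃ k, A k), hAB, hne]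
    simp
  have hAne : (⋃ k, A k).Nonempty := by
    by_contra hne
    rw [not_nonempty_iff_eq_empty] at hne
    refine hcon.2 (hBE.mono fun t ht ↦ ht ?_)
    rw [← hAB, hne]
    simp
  rcases exists_Ioo_subset_of_iUnion_union_iUnion (hclosed E) (hclosed Eᶜ) (hmono E) (hmono Eᶜ)
    hAB hAne hBne with ⟨k, t, ht, hI | hI⟩ | ⟨k, t, ht, hI | hI⟩
  · exact (hu k t ht).1 (hBE.mono fun s hs hsI ↦ hs (hI hsI))
  · exact (hu k t ht).2 (hBE.mono fun s hs hsI ↦ hs (hI hsI))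
  · exact (hu' k t ht).1 (hAE.mono fun s hs hsI ↦ hs (hI hsI))
  · exact (hu' k t ht).2 (hAE.mono fun s hs hsI ↦ hs (hI hsI))

theorem densTendsto_one_iff {N : ℕ} {E : Set (Pt N)} (hE : MeasurableSet E) {x : Pt N} :
    densTendsto E x 1 ↔ densTendsto Eᶜ x 0 := by
  have key : ∀ {F : Set (Pt N)}, MeasurableSet F → ∀ᶠ r in 𝓝[>] (0 : ℝ),
      1 - volume (F ∩ ball x r) / volume (ball x r) = volume (Fᶜ ∩ ball x r) / volume (ball x r) := by
    intro F hF
    filter_upwards [self_mem_nhdsWithin] with r hr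
    have h0 : volume (ball x r) ≠ 0 := (measure_ball_pos volume x hr).ne'
    have ht : volume (ball x r) ≠ ⊤ := measure_ball_lt_top.ne
    have hsplit : volume (F ∩ ball x r) + volume (Fᶜ ∩ ball x r) = volume (ball x r) := by
      rw [inter_comm F, inter_comm Fᶜ, ← sdiff_eq]
      exact measure_inter_add_sdiff _ hF
    refine ENNReal.sub_eq_of_eq_add_rev ?_ ?_
    · exact (ENNReal.div_lt_top (measure_lt_top_mono inter_subset_right measure_ball_lt_top).ne
        h0).ne
    · rw [← ENNReal.add_div, hsplit, ENNReal.div_self h0 ht]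
  constructor
  · intro h
    have := (ENNReal.Tendsto.sub (tendsto_const_nhds (x := (1 : ENNReal))) h
      (Or.inl ENNReal.one_ne_top)).congr' (key hE)
    simpa [densTendsto] using this
  · intro h
    have := (ENNReal.Tendsto.sub (tendsto_const_nhds (x := (1 : ENNReal))) h
      (Or.inl ENNReal.one_ne_top)).congr' (key hE.compl)
    simpa [densTendsto] using this

theorem densTendsto_zero_mono {N : ℕ} {E F : Set (Pt N)} (hEF : E ≤ᵐ[volume] F) {x : Pt N}
    (hF : densTendsto F x 0) : densTendsto E x 0 :=
  tendsto_of_tendsto_of_tendsto_of_le_of_le tendsto_const_nhds hF (fun _ ↦ zero_le)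
    fun _ ↦ ENNReal.div_le_div_right
      (measure_mono_ae (hEF.mono fun _ hy hyE ↦ ⟨hy hyE.1, hyE.2⟩)) _

theorem densTendsto_zero_biUnion {N : ℕ} {ι : Type*} [Finite ι] {E : ι → Set (Pt N)} {A : Set ι}
    {x : Pt N} (h : ∀ i ∈ A, densTendsto (E i) x 0) : densTendsto (⋃ i ∈ A, E i) x 0 := by
  have hA := A.toFinite
  have hsum : Tendsto (fun r : ℝ ↦ ∑ i ∈ hA.toFinset, volume (E i ∩ ball x r) / volume (ball x r))
      (𝓝[>] 0) (𝓝 0) := by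
    simpa using tendsto_finsetSum hA.toFinset fun i hi ↦ h i (hA.mem_toFinset.1 hi)
  refine tendsto_of_tendsto_of_tendsto_of_le_of_le tendsto_const_nhds hsum (fun _ ↦ zero_le)
    fun r ↦ ?_
  simp only [div_eq_mul_inv, ← Finset.sum_mul]
  gcongr
  rw [iUnion₂_inter]
  simpa using measure_biUnion_finset_le hA.toFinset fun i ↦ E i ∩ ball x r

/-- The splitting of `ℝⁿ⁺¹` into its `i`-th coordinate and the other ones. -/
def coordSplit {n : ℕ} (i : Fin (n + 1)) : Pt (n + 1) ≃ᵐ ℝ × (Fin n → ℝ) :=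
  (MeasurableEquiv.toLp 2 (Fin (n + 1) → ℝ)).symm.trans
    (MeasurableEquiv.piFinSuccAbove (fun _ ↦ ℝ) i)

theorem coordSplit_apply {n : ℕ} (i : Fin (n + 1)) (x : Pt (n + 1)) :
    coordSplit i x = (x i, fun j ↦ x (i.succAbove j)) := rfl

theorem measurePreserving_coordSplit {n : ℕ} (i : Fin (n + 1)) :
    MeasurePreserving (coordSplit i) volume volume :=
  (volume_preserving_piFinSuccAbove (fun _ : Fin (n + 1) ↦ ℝ) i).comp
    (EuclideanSpace.volume_preserving_symm_measurableEquiv_toLp (Fin (n + 1)))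

theorem dist_coordSplit {n : ℕ} (i : Fin (n + 1)) (x y : Pt (n + 1)) :
    dist (coordSplit i x) (coordSplit i y) = dist (WithLp.ofLp x) (WithLp.ofLp y) := by
  rw [coordSplit_apply, coordSplit_apply, Prod.dist_eq]
  apply le_antisymm
  · exact max_le (dist_le_pi_dist _ _ i)
      ((dist_pi_le_iff dist_nonneg).2 fun j ↦ dist_le_pi_dist x.ofLp y.ofLp (i.succAbove j))
  · rw [dist_pi_le_iff (by positivity), Fin.forall_iff_succAbove i]
    exact ⟨le_max_left _ _, fun j ↦ le_max_of_le_right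
      (dist_le_pi_dist (fun j ↦ x (i.succAbove j)) (fun j ↦ y (i.succAbove j)) j)⟩

theorem exists_coordSplit_mem_smallDensitySet {n : ℕ} (i : Fin (n + 1)) {E : Set (Pt (n + 1))}
    {x : Pt (n + 1)} (h : densTendsto E x 0) :
    ∃ k : ℕ, coordSplit i x ∈ smallDensitySet ((coordSplit i).symm ⁻¹' E) (1 / ((k : ℝ) + 1)) := by
  obtain ⟨K, hK0, hK⟩ : ∃ K : ℝ, 0 < K ∧ ∀ y : Pt (n + 1),
      dist y x ≤ K * dist (coordSplit i y) (coordSplit i x) := by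
    have hL := PiLp.antilipschitzWith_ofLp 2 (fun _ : Fin (n + 1) ↦ ℝ)
    refine ⟨_, ?_, fun y ↦ (hL.le_mul_dist y x).trans_eq (by rw [dist_coordSplit])⟩
    push_cast
    positivity
  apply exists_mem_smallDensitySet
  set v : ENNReal := volume (ball (0 : Pt (n + 1)) 1)
  have hv0 : v ≠ 0 := (measure_ball_pos volume _ one_pos).ne'
  have hvt : v ≠ ⊤ := measure_ball_lt_top.ne
  set c : ENNReal := ENNReal.ofReal ((1 / 3) ^ (n + 2) / K ^ (n + 1)) / v
  have hc : 0 < c := ENNReal.div_pos (ENNReal.ofReal_pos.2 (by positivity)).ne' hvt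
  have hscale : Tendsto (fun r : ℝ ↦ K * r) (𝓝[>] 0) (𝓝[>] 0) := by
    refine tendsto_nhdsWithin_iff.2 ⟨?_, ?_⟩
    · have : Tendsto (fun r : ℝ ↦ K * r) (𝓝 0) (𝓝 (K * 0)) := tendsto_id.const_mul K
      rw [mul_zero] at this
      exact this.mono_left nhdsWithin_le_nhds
    · filter_upwards [self_mem_nhdsWithin] with r hr using mul_pos hK0 hr
  filter_upwards [(h.comp hscale).eventually_lt_const hc, self_mem_nhdsWithin] with r hr hr0
  have hr0 : 0 < r := hr0
  rw [← (measurePreserving_coordSplit i).measure_preimage_equiv]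
  have hsub : coordSplit i ⁻¹' ((coordSplit i).symm ⁻¹' E ∩ ball (coordSplit i x) r) ⊆
      E ∩ ball x (K * r) := by
    rintro y ⟨hyE, hyb⟩
    refine ⟨by simpa using hyE, (hK y).trans_lt (mul_lt_mul_of_pos_left hyb hK0)⟩
  refine (measure_mono hsub).trans ?_
  have hball : volume (ball x (K * r)) = ENNReal.ofReal ((K * r) ^ (n + 1)) * v := by
    rw [Measure.addHaar_ball_of_pos volume x (by positivity), finrank_euclideanSpace_fin]
  have hb0 : volume (ball x (K * r)) ≠ 0 := (measure_ball_pos volume _ (by positivity)).ne'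
  have hr' := ((ENNReal.div_lt_iff (Or.inl hb0) (Or.inl measure_ball_lt_top.ne)).1 hr).le
  refine hr'.trans_eq ?_
  rw [hball, mul_left_comm, ENNReal.div_mul_cancel hv0 hvt, ← ENNReal.ofReal_mul (by positivity)]
  congr 1
  rw [mul_pow]
  field_simp

theorem ae_coordSplit_vertical_line {n : ℕ} (i : Fin (n + 1)) {E : Set (Pt (n + 1))}
    (hE : MeasurableSet E) (hH : μH[(n : ℝ)] (essBdry E) = 0) :
    ∀ᵐ z : Fin n → ℝ, (∀ᵐ t : ℝ, (coordSplit i).symm (t, z) ∉ E) ∨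
      (∀ᵐ t : ℝ, (coordSplit i).symm (t, z) ∈ E) := by
  refine ae_vertical_line_trivial (E := (coordSplit i).symm ⁻¹' E)
    ((coordSplit i).symm.measurable hE) ?_
  have hproj : LipschitzWith 1 fun x : Pt (n + 1) ↦ (coordSplit i x).2 := by
    refine LipschitzWith.mk_one fun x y ↦ ?_
    calc dist (coordSplit i x).2 (coordSplit i y).2
        ≤ dist (coordSplit i x) (coordSplit i y) := le_max_right _ _
      _ ≤ dist x y := by
        rw [dist_coordSplit]
        simpa using (PiLp.lipschitzWith_ofLp 2 (fun _ : Fin (n + 1) ↦ ℝ)).dist_le_mul x y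
  have hnull : volume ((fun x : Pt (n + 1) ↦ (coordSplit i x).2) '' essBdry E) = 0 := by
    have hle := hproj.hausdorffMeasure_image_le n.cast_nonneg (essBdry E)
    rw [hH, mul_zero, nonpos_iff_eq_zero] at hle
    have hvol := hausdorffMeasure_pi_real (ι := Fin n)
    rw [Fintype.card_fin] at hvol
    rwa [← hvol]
  filter_upwards [measure_eq_zero_iff_ae_notMem.1 hnull] with z hz t
  have hx : (coordSplit i).symm (t, z) ∉ essBdry E := fun hx ↦ hz ⟨_, hx, by simp⟩
  have hx' : densTendsto E ((coordSplit i).symm (t, z)) 0 ∨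
      densTendsto Eᶜ ((coordSplit i).symm (t, z)) 0 := by
    rw [← densTendsto_one_iff hE]
    by_contra hcon
    exact hx (not_or.1 hcon)
  refine hx'.imp (fun h ↦ ?_) fun h ↦ ?_
  · simpa using exists_coordSplit_mem_smallDensitySet i h
  · simpa using exists_coordSplit_mem_smallDensitySet i h

theorem preimage_add_single_ae_eq {n : ℕ} (i : Fin (n + 1)) (c : ℝ) {E : Set (Pt (n + 1))}
    (hE : MeasurableSet E) (hH : μH[(n : ℝ)] (essBdry E) = 0) :
    ∀ᵐ x, EuclideanSpace.single i c + x ∈ E ↔ x ∈ E := by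
  set F := (coordSplit i).symm ⁻¹' E
  have hF : MeasurableSet F := (coordSplit i).symm.measurable hE
  have hcol : ∀ᵐ z : Fin n → ℝ, ∀ᵐ t : ℝ, (c + t, z) ∈ F ↔ (t, z) ∈ F := by
    filter_upwards [ae_coordSplit_vertical_line i hE hH] with z hz
    have htr := (measurePreserving_add_left (volume : Measure ℝ) c).quasiMeasurePreserving
    rcases hz with hz | hz
    · filter_upwards [hz, htr.ae hz] with t h1 h2 using iff_of_false h2 h1
    · filter_upwards [hz, htr.ae hz] with t h1 h2 using iff_of_true h2 h1
  have hmeas : MeasurableSet {p : (Fin n → ℝ) × ℝ | (c + p.2, p.1) ∈ F ↔ (p.2, p.1) ∈ F} := by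
    have h1 : Measurable fun p : (Fin n → ℝ) × ℝ ↦ (c + p.2, p.1) := by fun_prop
    exact ((h1 hF).mem.iff (measurable_swap hF).mem).setOf
  have hprod := (Measure.measurePreserving_swap (μ := (volume : Measure ℝ))
    (ν := (volume : Measure (Fin n → ℝ)))).quasiMeasurePreserving.ae
      ((Measure.ae_prod_iff_ae_ae hmeas).2 hcol)
  filter_upwards [(measurePreserving_coordSplit i).quasiMeasurePreserving.ae hprod] with x hx
  have hshift : (coordSplit i).symm (c + x i, fun j ↦ x (i.succAbove j)) =
      EuclideanSpace.single i c + x := by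
    rw [MeasurableEquiv.symm_apply_eq, coordSplit_apply]
    simp
  have hx' : (c + x i, fun j ↦ x (i.succAbove j)) ∈ F ↔ coordSplit i x ∈ F := hx
  simpa only [F, mem_preimage, hshift, MeasurableEquiv.symm_apply_apply] using hx'

/-- A measurable set whose essential boundary is negligible for the `n`-dimensional Hausdorff
measure in `ℝⁿ⁺¹` is null or conull. -/
theorem volume_eq_zero_or_of_hausdorffMeasure_essBdry_eq_zero {n : ℕ} {E : Set (Pt (n + 1))}
    (hE : MeasurableSet E) (hH : μH[(n : ℝ)] (essBdry E) = 0) :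
    volume E = 0 ∨ volume Eᶜ = 0 := by
  have htrans : ∀ g : Pt (n + 1), ∀ᵐ x, g + x ∈ E ↔ x ∈ E := by
    intro g
    have hg : g = ∑ i, EuclideanSpace.single i (g i) := by
      ext j
      simp [Pi.single_apply]
    rw [hg]
    refine Finset.sum_induction _ (fun g : Pt (n + 1) ↦ ∀ᵐ x, g + x ∈ E ↔ x ∈ E) ?_ (by simp)
      fun i _ ↦ preimage_add_single_ae_eq i (g i) hE hH
    intro a b ha hb
    filter_upwards [(measurePreserving_add_left volume b).quasiMeasurePreserving.ae ha, hb]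
      with x h1 h2
    rw [add_assoc, h1, h2]
  have hconst : EventuallyConst E (ae volume) :=
    aeconst_of_forall_preimage_vadd_ae_eq (Pt (n + 1)) hE.nullMeasurableSet
      fun g ↦ eventuallyEq_set.2 (htrans g)
  rcases eventuallyConst_set.1 hconst with h | h
  · exact Or.inr (mem_ae_iff.1 h)
  · exact Or.inl (measure_eq_zero_iff_ae_notMem.2 h)

/-- The essential boundary of the union of some chambers of a partition is contained in the
interfaces between these chambers and the other ones. -/
theorem essBdry_biUnion_subset {N : ℕ} {ι : Type*} [Finite ι] {E : ι → Set (Pt N)}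
    (hmeas : ∀ i, MeasurableSet (E i)) (hdisj : ∀ i j, i ≠ j → volume (E i ∩ E j) = 0)
    (hcover : volume (⋃ i, E i)ᶜ = 0) (A : Set ι) :
    essBdry (⋃ a ∈ A, E a) ⊆ ⋃ a ∈ A, ⋃ b ∈ Aᶜ, essBdry (E a) ∩ essBdry (E b) := by
  intro x hx
  set F := ⋃ a ∈ A, E a
  have hF : MeasurableSet F := .biUnion A.to_countable fun a _ ↦ hmeas a
  obtain ⟨hx0, hx1⟩ := hx
  rw [densTendsto_one_iff hF] at hx1
  obtain ⟨a, haA, ha⟩ : ∃ a ∈ A, ¬ densTendsto (E a) x 0 := by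
    by_contra! hcon
    exact hx0 (densTendsto_zero_biUnion hcon)
  obtain ⟨b, hbA, hb⟩ : ∃ b ∈ Aᶜ, ¬ densTendsto (E b) x 0 := by
    by_contra! hcon
    refine hx1 (densTendsto_zero_mono ?_ (densTendsto_zero_biUnion hcon))
    filter_upwards [measure_eq_zero_iff_ae_notMem.1 hcover] with y hy hyF
    obtain ⟨j, hj⟩ := mem_iUnion.1 (not_not.1 hy)
    exact mem_iUnion₂.2 ⟨j, fun hjA ↦ hyF (mem_iUnion₂.2 ⟨j, hjA, hj⟩), hj⟩
  refine mem_iUnion₂.2 ⟨a, haA, mem_iUnion₂.2 ⟨b, hbA, ⟨ha, fun h ↦ hx1 ?_⟩, hb, fun h ↦ hx0 ?_⟩⟩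
  · refine densTendsto_zero_mono ?_ ((densTendsto_one_iff (hmeas a)).1 h)
    exact (compl_subset_compl.2 (subset_biUnion_of_mem haA)).eventuallyLE
  · refine densTendsto_zero_mono ?_ ((densTendsto_one_iff (hmeas b)).1 h)
    have hnull : volume (⋃ a ∈ A, E a ∩ E b) = 0 :=
      (measure_biUnion_null_iff A.to_countable).2 fun a ha ↦
        hdisj a b fun hab ↦ hbA (hab ▸ ha)
    filter_upwards [measure_eq_zero_iff_ae_notMem.1 hnull] with y hy hyF hyb
    rw [← iUnion₂_inter] at hy
    exact hy ⟨hyF, hyb⟩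

/-- the connectivity of the chambers of a partition of `ℝ^N` through the
relation "positive `H^{N−1}` measure of the common essential boundary, with the extra
condition involving the chamber `E₀`": every two indices are joined by a finite chain. -/
theorem chamber_connectivity (N m : ℕ) (hN : 2 ≤ N)
    (E : Fin (m + 1) → Set (Pt N))
    (hmeas : ∀ i, MeasurableSet (E i))
    (hdisj : ∀ i j, i ≠ j → volume (E i ∩ E j) = 0)
    (hcover : volume ((⋃ i, E i)ᶜ) = 0)
    (hpos : ∀ i, 0 < volume (E i))
    (hfin : ∀ i, μH[(N : ℝ) - 1] (essBdry (E i)) < ⊤) :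
    ∀ i j : Fin (m + 1),
      Relation.ReflTransGen
        (fun a b : Fin (m + 1) => a ≠ b ∧
          0 < μH[(N : ℝ) - 1] (essBdry (E a) ∩ essBdry (E b)) ∧
          (a = 0 ∨ b = 0 ∨
            μH[(N : ℝ) - 1] (essBdry (E a) ∩ essBdry (E 0)) = 0 ∨
            μH[(N : ℝ) - 1] (essBdry (E b) ∩ essBdry (E 0)) = 0))
        i j := by
  obtain ⟨n, rfl⟩ : ∃ n, N = n + 1 := ⟨N - 1, by omega⟩
  have hdim : ((n + 1 : ℕ) : ℝ) - 1 = n := by push_cast; ring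
  rw [hdim]
  intro i j
  set R : Fin (m + 1) → Fin (m + 1) → Prop := fun a b ↦ a ≠ b ∧
    0 < μH[(n : ℝ)] (essBdry (E a) ∩ essBdry (E b)) ∧
    (a = 0 ∨ b = 0 ∨ μH[(n : ℝ)] (essBdry (E a) ∩ essBdry (E 0)) = 0 ∨
      μH[(n : ℝ)] (essBdry (E b) ∩ essBdry (E 0)) = 0)
  by_contra hj
  set A : Set (Fin (m + 1)) := {a | Relation.ReflTransGen R i a}
  set F := ⋃ a ∈ A, E a
  have hF : MeasurableSet F := .biUnion A.to_countable fun a _ ↦ hmeas a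
  have hF0 : volume F ≠ 0 :=
    ((hpos i).trans_le (measure_mono
      (subset_biUnion_of_mem (u := E) (show i ∈ A from Relation.ReflTransGen.refl)))).ne'
  have hF1 : volume Fᶜ ≠ 0 := by
    refine ((hpos j).trans_le (measure_mono_ae ?_)).ne'
    have hnull : volume (⋃ a ∈ A, E a ∩ E j) = 0 :=
      (measure_biUnion_null_iff A.to_countable).2 fun a ha ↦ hdisj a j fun haj ↦ hj (haj ▸ ha)
    filter_upwards [measure_eq_zero_iff_ae_notMem.1 hnull] with y hy hyj hyF
    rw [← iUnion₂_inter] at hy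
    exact hy ⟨hyF, hyj⟩
  have hne : μH[(n : ℝ)] (⋃ a ∈ A, ⋃ b ∈ Aᶜ, essBdry (E a) ∩ essBdry (E b)) ≠ 0 := fun h0 ↦
    (volume_eq_zero_or_of_hausdorffMeasure_essBdry_eq_zero hF
      (measure_mono_null (essBdry_biUnion_subset hmeas hdisj hcover A) h0)).elim hF0 hF1
  obtain ⟨a, ha, b, hb, hab⟩ : ∃ a ∈ A, ∃ b ∈ Aᶜ,
      μH[(n : ℝ)] (essBdry (E a) ∩ essBdry (E b)) ≠ 0 := by
    by_contra! hcon
    exact hne ((measure_biUnion_null_iff A.to_countable).2 fun a ha ↦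
      (measure_biUnion_null_iff Aᶜ.to_countable).2 fun b hb ↦ hcon a ha b hb)
  have hne_ab : a ≠ b := fun h ↦ hb (h ▸ ha)
  by_cases hcond : a = 0 ∨ b = 0 ∨ μH[(n : ℝ)] (essBdry (E a) ∩ essBdry (E 0)) = 0 ∨
      μH[(n : ℝ)] (essBdry (E b) ∩ essBdry (E 0)) = 0
  · exact hb (Relation.ReflTransGen.tail ha ⟨hne_ab, pos_iff_ne_zero.2 hab, hcond⟩)
  · simp only [not_or] at hcond
    obtain ⟨ha0, hb0, hHa, hHb⟩ := hcond
    refine hb (Relation.ReflTransGen.tail (Relation.ReflTransGen.tail ha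
      (show R a 0 from ⟨ha0, pos_iff_ne_zero.2 hHa, Or.inr (Or.inl rfl)⟩))
      (show R 0 b from ⟨Ne.symm hb0, ?_, Or.inl rfl⟩))
    rw [inter_comm]
    exact pos_iff_ne_zero.2 hHb
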